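/- Let τ⁺_0 := 0 and τ⁺_{ℓ+1} := inf{i > τ⁺_ℓ : Z̄_{i−1} < 0 and Z̄_i = 1} for the chain (Z̄_k)_{k≥0} associated with semi-Baxter permutations. The increments τ⁺_{ℓ+1} − τ⁺_ℓ for ℓ ≥ 1 are identically distributed, and, as k → ∞, P(τ⁺_2 − τ⁺_1 = k) ∼ β k^{−3/2}, where β = (1/√(2π)) · (1/(1−γ)) · (1/σ' + (1+γ)/σ). -/

import Mathlib

attribute [local instance] Classical.propDecidable

noncomputable section

/-- `α = √5 - 2`. -/
def semiα : ℝ := Real.sqrt 5 - 2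

/-- `γ = (√5 - 1)/2`. -/
def semiγ : ℝ := (Real.sqrt 5 - 1) / 2

/-- `σ = √(2(2+√5))`. -/
def semiσ : ℝ := Real.sqrt (2 * (2 + Real.sqrt 5))

/-- `σ' = √(1+√5)`. -/
def semiσ' : ℝ := Real.sqrt (1 + Real.sqrt 5)

/-- The constant `β = (1/√(2π)) · (1/(1-γ)) · (1/σ' + (1+γ)/σ)`. -/
def semiβ : ℝ :=
  (1 / Real.sqrt (2 * Real.pi)) * (1 / (1 - semiγ)) * (1 / semiσ' + (1 + semiγ) / semiσ)

/-- The step distribution `μ_sb`: `(-i,1) ↦ αγ^i` for `i ≥ 0` and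
`(i,-i+1) ↦ αγ^i` for `i ≥ 1`. -/
def wSemi (d : ℤ × ℤ) : ℝ :=
  if d.1 ≤ 0 ∧ d.2 = 1 then semiα * semiγ ^ (-d.1).toNat
  else if 1 ≤ d.1 ∧ d.2 = 1 - d.1 then semiα * semiγ ^ d.1.toNat
  else 0

/-- One step of the coalescent chain for semi-Baxter permutations. -/
def zStep (z : ℤ) (d : ℤ × ℤ) : ℤ :=
  if 0 ≤ z ∧ 0 < z + d.2 then z + d.2
  else if (0 ≤ z ∧ z + d.2 ≤ 0) ∨ (z < 0 ∧ z - d.1 < 0) then z - d.1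
  else 1

/-- The chain `Z̄`, driven by the sequence of increments `f` of the walk `W̄`. -/
def zbar (f : ℕ → ℤ × ℤ) : ℕ → ℤ
  | 0 => 0
  | ℓ + 1 => zStep (zbar f ℓ) (f ℓ)

/-- Extension of a finite tuple of increments by a dummy value. -/
def extFin {m : ℕ} (g : Fin m → ℤ × ℤ) : ℕ → ℤ × ℤ :=
  fun i => if h : i < m then g ⟨i, h⟩ else (0, 0)

/-- Probability of an event depending only on the first `m` i.i.d. increments
(with step distribution `μ_sb`). -/
def probSemi (m : ℕ) (E : (ℕ → ℤ × ℤ) → Prop) : ℝ :=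
  ∑' g : Fin m → ℤ × ℤ, if E (extFin g) then ∏ i, wSemi (g i) else 0

/-- `r` is a renewal time: `Z̄_{r-1} < 0` and `Z̄_r = 1`. -/
def isRenewal (f : ℕ → ℤ × ℤ) (r : ℕ) : Prop :=
  zbar f (r - 1) < 0 ∧ zbar f r = 1

/-- The number of renewal times of `Z̄` among the times `1,…,i`. -/
def renewalCount (f : ℕ → ℤ × ℤ) (i : ℕ) : ℕ :=
  ((Finset.Icc 1 i).filter fun r => isRenewal f r).card

/-- `P(τ⁺_{ℓ+1} - τ⁺_ℓ = k)`, where `τ⁺₀ = 0` and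
`τ⁺_{ℓ+1} = inf{i > τ⁺_ℓ : Z̄_{i-1} < 0 ∧ Z̄_i = 1}`: this is
`Σ_j P(τ⁺_ℓ = j, τ⁺_{ℓ+1} = j + k)`. -/
def diffProbSemi (ℓ k : ℕ) : ℝ :=
  ∑' j : ℕ, probSemi (j + k) fun f =>
    (if ℓ = 0 then j = 0 else (isRenewal f j ∧ renewalCount f j = ℓ)) ∧
      isRenewal f (j + k) ∧ renewalCount f (j + k) = ℓ + 1

section Helpers

/-! ### Part 1: the probabilistic decomposition -/

open scoped ENNReal

/-- The chain started at `z`. -/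
def zb (z : ℤ) (f : ℕ → ℤ × ℤ) : ℕ → ℤ
  | 0 => z
  | n + 1 => zStep (zb z f n) (f n)

lemma zbar_eq_zb (f : ℕ → ℤ × ℤ) (n : ℕ) : zbar f n = zb 0 f n := by
  induction n with
  | zero => rfl
  | succ n ih => simp only [zbar, zb, ih]

def ren (z : ℤ) (f : ℕ → ℤ × ℤ) (r : ℕ) : Prop := zb z f (r - 1) < 0 ∧ zb z f r = 1

def cnt (z : ℤ) (f : ℕ → ℤ × ℤ) : ℕ → ℕ
  | 0 => 0
  | i + 1 => cnt z f i + if ren z f (i + 1) then 1 else 0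

lemma isRenewal_iff (f : ℕ → ℤ × ℤ) (r : ℕ) : isRenewal f r ↔ ren 0 f r := by
  simp only [isRenewal, ren, zbar_eq_zb]

lemma renewalCount_eq (f : ℕ → ℤ × ℤ) (i : ℕ) : renewalCount f i = cnt 0 f i := by
  induction i with
  | zero => simp [renewalCount, cnt]
  | succ i ih =>
    rw [cnt, ← ih, renewalCount, renewalCount, ← Finset.insert_Icc_right_eq_Icc_add_one (by omega),
      Finset.filter_insert]
    by_cases h : isRenewal f (i + 1)
    · rw [if_pos h, if_pos ((isRenewal_iff _ _).1 h), Finset.card_insert_of_notMem]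
      simp
    · rw [if_neg h, if_neg (fun h' => h ((isRenewal_iff _ _).2 h'))]; simp

lemma zb_add (z : ℤ) (f : ℕ → ℤ × ℤ) (j i : ℕ) :
    zb z f (j + i) = zb (zb z f j) (fun t => f (j + t)) i := by
  induction i with
  | zero => rfl
  | succ i ih => rw [← add_assoc, zb, zb, ih]

lemma ren_add (z : ℤ) (f : ℕ → ℤ × ℤ) (j i : ℕ) :
    ren z f (j + (i + 1)) ↔ ren (zb z f j) (fun t => f (j + t)) (i + 1) := by
  have : j + (i + 1) - 1 = j + i := by omega
  simp only [ren, this, zb_add, Nat.add_sub_cancel]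

lemma cnt_add (z : ℤ) (f : ℕ → ℤ × ℤ) (j i : ℕ) :
    cnt z f (j + i) = cnt z f j + cnt (zb z f j) (fun t => f (j + t)) i := by
  induction i with
  | zero => rfl
  | succ i ih =>
    rw [← add_assoc, cnt, cnt, ih, add_assoc (cnt z f j)]
    simp only [← ren_add, add_assoc]

lemma not_ren_zero (z : ℤ) (f : ℕ → ℤ × ℤ) : ¬ ren z f 0 := by
  rintro ⟨h1, h2⟩
  simp [zb] at h1 h2; omega

lemma ren_cnt_pos (z : ℤ) (f : ℕ → ℤ × ℤ) (r : ℕ) (h : ren z f r) : 1 ≤ cnt z f r := by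
  cases r with
  | zero => exact absurd h (not_ren_zero _ _)
  | succ r => rw [cnt, if_pos h]; omega

def ev (z : ℤ) (l k : ℕ) (f : ℕ → ℤ × ℤ) : Prop := ren z f k ∧ cnt z f k = l

lemma zb_congr (z : ℤ) (f f' : ℕ → ℤ × ℤ) (n : ℕ) (h : ∀ i < n, f i = f' i) :
    zb z f n = zb z f' n := by
  induction n with
  | zero => rfl
  | succ n ih => rw [zb, zb, ih (fun i hi => h i (by omega)), h n (by omega)]

lemma ren_congr (z : ℤ) (f f' : ℕ → ℤ × ℤ) (n : ℕ) (h : ∀ i < n, f i = f' i) :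
    ren z f n ↔ ren z f' n := by
  rw [ren, ren, zb_congr z f f' n h, zb_congr z f f' (n - 1) (fun i hi => h i (by omega))]

lemma cnt_congr (z : ℤ) (f f' : ℕ → ℤ × ℤ) (n : ℕ) (h : ∀ i < n, f i = f' i) :
    cnt z f n = cnt z f' n := by
  induction n with
  | zero => rfl
  | succ n ih =>
    rw [cnt, cnt, ih (fun i hi => h i (by omega))]
    simp only [ren_congr z f f' (n + 1) h]

lemma ev_congr (z : ℤ) (l : ℕ) (f f' : ℕ → ℤ × ℤ) (n : ℕ) (h : ∀ i < n, f i = f' i) :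
    ev z l n f ↔ ev z l n f' := by
  rw [ev, ev, ren_congr z f f' n h, cnt_congr z f f' n h]

/-- Splitting the event at the `l`-th renewal time. -/
lemma ev_split (l j k : ℕ) (f : ℕ → ℤ × ℤ) :
    (ev 0 l j f ∧ ev 0 (l + 1) (j + k) f) ↔ (ev 0 l j f ∧ ev 1 1 k (fun t => f (j + t))) := by
  refine and_congr_right fun h => ?_
  have hz : zb 0 f j = 1 := h.1.2
  have hc : cnt 0 f j = l := h.2
  cases k with
  | zero =>
    constructor
    · intro h2; have := h2.2; simp at this; omega
    · intro h2; exact absurd h2.1 (not_ren_zero _ _)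
  | succ k =>
    rw [ev, ev, ren_add, cnt_add, hz, hc]
    refine and_congr_right fun _ => ?_
    omega

lemma cnt_mono (z : ℤ) (f : ℕ → ℤ × ℤ) : Monotone (cnt z f) := by
  refine monotone_nat_of_le_succ fun n => ?_
  rw [cnt]; omega

lemma ev_unique (z : ℤ) (f : ℕ → ℤ × ℤ) (l i j : ℕ) (hi : ev z l i f) (hj : ev z l j f) :
    i = j := by
  by_contra hne
  wlog hlt : i < j generalizing i j
  · exact this j i hj hi (Ne.symm hne) (by omega)
  obtain ⟨m, rfl⟩ : ∃ m, j = m + 1 := ⟨j - 1, by omega⟩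
  have h1 := cnt_mono z f (show i ≤ m by omega)
  have h2 := hj.2
  rw [cnt, if_pos hj.1] at h2
  have h3 := hi.2
  omega

lemma ev_exists (z : ℤ) (f : ℕ → ℤ × ℤ) (l n : ℕ) (hl : 1 ≤ l) (hn : l ≤ cnt z f n) :
    ∃ j ≤ n, ev z l j f := by
  have hex : ∃ j, l ≤ cnt z f j := ⟨n, hn⟩
  refine ⟨Nat.find hex, Nat.find_le hn, ?_⟩
  have hs := Nat.find_spec hex
  have hmin : ∀ m < Nat.find hex, ¬ l ≤ cnt z f m := fun m hm => Nat.find_min hex hm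
  generalize Nat.find hex = j at hs hmin
  cases j with
  | zero => simp [cnt] at hs; omega
  | succ j =>
    have h1 := hmin j (by omega)
    have h2 := hs
    rw [cnt] at h2
    by_cases hr : ren z f (j + 1)
    · refine ⟨hr, ?_⟩
      rw [if_pos hr] at h2
      rw [cnt, if_pos hr]; omega
    · rw [if_neg hr] at h2; omega

/-- Extended non-negative weights. -/
def wE (d : ℤ × ℤ) : ℝ≥0∞ := ENNReal.ofReal (wSemi d)

def PE (m : ℕ) (E : (ℕ → ℤ × ℤ) → Prop) : ℝ≥0∞ :=
  ∑' g : Fin m → ℤ × ℤ, if E (extFin g) then ∏ i, wE (g i) else 0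

lemma sqrt5_sq : Real.sqrt 5 ^ 2 = 5 := Real.sq_sqrt (by norm_num)

lemma sqrt5_bounds : 2.236 < Real.sqrt 5 ∧ Real.sqrt 5 < 2.2361 := by
  constructor
  · exact Real.lt_sqrt_of_sq_lt (by norm_num)
  · rw [Real.sqrt_lt' (by norm_num)]; norm_num

lemma γ_bounds : 0.618 ≤ semiγ ∧ semiγ < 0.6181 := by
  have := sqrt5_bounds
  unfold semiγ
  constructor <;> norm_num at * <;> linarith

lemma γ_pos : 0 < semiγ := lt_of_lt_of_le (by norm_num) γ_bounds.1
lemma γ_lt : semiγ < 1 := lt_trans γ_bounds.2 (by norm_num)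

lemma γ_sq : semiγ ^ 2 = 1 - semiγ := by
  have := sqrt5_sq
  unfold semiγ; nlinarith

lemma α_eq : semiα = semiγ ^ 3 := by
  have h := γ_sq
  have : semiγ ^ 3 = 2 * semiγ - 1 := by
    have : semiγ ^ 3 = semiγ * semiγ ^ 2 := by ring
    rw [this, h]; linarith [h, show semiγ * (1 - semiγ) = semiγ - semiγ ^ 2 by ring]
  rw [this]; unfold semiα semiγ; ring

lemma α_pos : 0 < semiα := by rw [α_eq]; exact pow_pos γ_pos 3

lemma wSemi_nonneg (d : ℤ × ℤ) : 0 ≤ wSemi d := by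
  unfold wSemi
  have := α_pos.le
  have := γ_pos.le
  split_ifs <;> positivity

lemma wSemi_left (i : ℕ) : wSemi (-(i : ℤ), 1) = semiα * semiγ ^ i := by
  simp [wSemi]

lemma wSemi_right (i : ℕ) : wSemi ((i : ℤ) + 1, -(i : ℤ)) = semiα * semiγ ^ (i + 1) := by
  have h1 : ¬ ((i : ℤ) + 1 ≤ 0 ∧ -(i : ℤ) = 1) := by omega
  have h2 : (1 : ℤ) ≤ (i : ℤ) + 1 ∧ -(i : ℤ) = 1 - ((i : ℤ) + 1) := by omega
  have h3 : ((i : ℤ) + 1).toNat = i + 1 := by omega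
  unfold wSemi
  rw [if_neg h1, if_pos h2, h3]

/-- Parametrisation of the support of the step distribution. -/
def stepMap : ℕ ⊕ ℕ → ℤ × ℤ
  | Sum.inl i => (-(i : ℤ), 1)
  | Sum.inr i => ((i : ℤ) + 1, -(i : ℤ))

lemma stepMap_inj : Function.Injective stepMap := by
  rintro (a | a) (b | b) h <;> simp [stepMap] at h ⊢ <;> omega

lemma tsum_wE (G : ℤ × ℤ → ℝ≥0∞) : ∑' d, wE d * G d =
    ∑' i : ℕ, ENNReal.ofReal (semiα * semiγ ^ i) * G (-(i : ℤ), 1) +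
    ∑' i : ℕ, ENNReal.ofReal (semiα * semiγ ^ (i + 1)) * G ((i : ℤ) + 1, -(i : ℤ)) := by
  rw [← stepMap_inj.tsum_eq]
  · rw [Summable.tsum_sum ENNReal.summable ENNReal.summable]
    simp only [stepMap, wE, wSemi_left, wSemi_right]
  · intro d hd
    by_contra hne
    apply hd
    have : wSemi d = 0 := by
      rcases d with ⟨x, y⟩
      unfold wSemi
      rw [if_neg, if_neg]
      · rintro ⟨h1, h2⟩
        simp only at h1 h2
        exact hne ⟨Sum.inr (x - 1).toNat, by simp only [stepMap, Prod.mk.injEq]; omega⟩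
      · rintro ⟨h1, h2⟩
        simp only at h1 h2
        exact hne ⟨Sum.inl (-x).toNat, by simp only [stepMap, Prod.mk.injEq]; omega⟩
    simp [wE, this]

lemma hasSum_γ (c : ℝ) : HasSum (fun i : ℕ => c * semiγ ^ i) (c * (semiγ ^ 2)⁻¹) := by
  rw [γ_sq]
  exact (hasSum_geometric_of_lt_one γ_pos.le γ_lt).mul_left c

lemma tsum_α : ∑' i : ℕ, ENNReal.ofReal (semiα * semiγ ^ i) = ENNReal.ofReal semiγ := by
  have hγ := γ_pos
  rw [← ENNReal.ofReal_tsum_of_nonneg (fun i => mul_nonneg α_pos.le (pow_nonneg hγ.le _))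
    (hasSum_γ _).summable, (hasSum_γ _).tsum_eq, α_eq]
  congr 1; field_simp

lemma tsum_α' : ∑' i : ℕ, ENNReal.ofReal (semiα * semiγ ^ (i + 1)) =
    ENNReal.ofReal (semiγ ^ 2) := by
  have hγ := γ_pos
  have : ∀ i : ℕ, semiα * semiγ ^ (i + 1) = (semiα * semiγ) * semiγ ^ i := fun i => by ring
  simp only [this]
  rw [← ENNReal.ofReal_tsum_of_nonneg
    (fun i => mul_nonneg (mul_nonneg α_pos.le hγ.le) (pow_nonneg hγ.le _))
    (hasSum_γ _).summable, (hasSum_γ _).tsum_eq, α_eq]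
  congr 1; field_simp

lemma tsum_wE_one : ∑' d, wE d = 1 := by
  have := tsum_wE (fun _ => 1)
  simp only [mul_one] at this
  rw [this, tsum_α, tsum_α', ← ENNReal.ofReal_add γ_pos.le (by positivity), γ_sq]
  simp

lemma prod_wE {m : ℕ} (g : Fin m → ℤ × ℤ) :
    (∏ i, wE (g i)).toReal = ∏ i, wSemi (g i) := by
  rw [ENNReal.toReal_prod]
  simp [wE, wSemi_nonneg]

lemma probSemi_eq (m : ℕ) (E : (ℕ → ℤ × ℤ) → Prop) : probSemi m E = (PE m E).toReal := by
  rw [PE, ENNReal.tsum_toReal_eq, probSemi]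
  · refine tsum_congr fun g => ?_
    split_ifs
    · exact (prod_wE g).symm
    · rfl
  · intro g
    split_ifs
    · exact ENNReal.prod_ne_top (fun i _ => ENNReal.ofReal_ne_top)
    · exact ENNReal.zero_ne_top

lemma PE_congr (m : ℕ) {E E' : (ℕ → ℤ × ℤ) → Prop} (h : ∀ f, E f ↔ E' f) : PE m E = PE m E' := by
  have : E = E' := funext fun f => propext (h f)
  rw [this]

def ncons (d : ℤ × ℤ) (f : ℕ → ℤ × ℤ) : ℕ → ℤ × ℤ
  | 0 => d
  | n + 1 => f n

lemma extFin_cons {m : ℕ} (d : ℤ × ℤ) (g : Fin m → ℤ × ℤ) :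
    extFin (Fin.cons d g : Fin (m + 1) → ℤ × ℤ) = ncons d (extFin g) := by
  funext i
  cases i with
  | zero => simp [extFin, ncons]
  | succ i =>
    simp only [extFin, ncons]
    by_cases h : i < m
    · rw [dif_pos h, dif_pos (by omega)]
      exact Fin.cons_succ (α := fun _ => ℤ × ℤ) d g ⟨i, h⟩
    · rw [dif_neg h, dif_neg (by omega)]

lemma PE_succ (m : ℕ) (E : (ℕ → ℤ × ℤ) → Prop) :
    PE (m + 1) E = ∑' d, wE d * PE m (fun f => E (ncons d f)) := by
  rw [PE, ← (Fin.consEquiv (fun _ : Fin (m + 1) => ℤ × ℤ)).tsum_eq, ENNReal.tsum_prod']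
  refine tsum_congr fun d => ?_
  rw [PE, ← ENNReal.tsum_mul_left]
  refine tsum_congr fun g => ?_
  have h : extFin ((Fin.consEquiv fun _ : Fin (m + 1) => ℤ × ℤ) (d, g)) = ncons d (extFin g) :=
    extFin_cons d g
  rw [h]
  split_ifs
  · rw [Fin.prod_univ_succ]; rfl
  · simp

lemma PE_le_one (m : ℕ) (E : (ℕ → ℤ × ℤ) → Prop) : PE m E ≤ 1 := by
  induction m generalizing E with
  | zero =>
    rw [PE, tsum_fintype]
    simp
    exact (Finset.card_filter_le _ _).trans (by simp)
  | succ m ih =>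
    rw [PE_succ, ← tsum_wE_one]
    refine ENNReal.tsum_le_tsum fun d => ?_
    calc _ ≤ wE d * 1 := by gcongr; exact ih _
      _ = _ := mul_one _

lemma PE_mul (j k : ℕ) (A B : (ℕ → ℤ × ℤ) → Prop)
    (hA : ∀ f f' : ℕ → ℤ × ℤ, (∀ i < j, f i = f' i) → (A f ↔ A f')) :
    PE (j + k) (fun f => A f ∧ B (fun t => f (j + t))) = PE j A * PE k B := by
  rw [PE, ← (Fin.appendEquiv j k).tsum_eq, ENNReal.tsum_prod', PE, ← ENNReal.tsum_mul_right]
  refine tsum_congr fun g => ?_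
  rw [PE, ← ENNReal.tsum_mul_left]
  refine tsum_congr fun h => ?_
  have e : (Fin.appendEquiv j k) (g, h) = Fin.append g h := rfl
  have h1 : A (extFin (Fin.append g h)) ↔ A (extFin g) := by
    refine hA _ _ fun i hi => ?_
    rw [extFin, extFin, dif_pos hi, dif_pos (by omega)]
    exact Fin.append_left g h ⟨i, hi⟩
  have h2 : (fun t => extFin (Fin.append g h) (j + t)) = extFin h := by
    funext t
    simp only [extFin]
    by_cases ht : t < k
    · rw [dif_pos ht, dif_pos (by omega)]
      exact Fin.append_right g h ⟨t, ht⟩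
    · rw [dif_neg ht, dif_neg (by omega)]
  rw [e, h1, h2, Fin.prod_univ_add]
  by_cases ha : A (extFin g) <;> by_cases hb : B (extFin h) <;> simp [ha, hb]

/-- Probability that the first renewal of the chain started at `z` is at time `k`. -/
def KK : ℕ → ℤ → ℝ≥0∞
  | 0, _ => 0
  | k + 1, z => ∑' d, wE d *
      (if z < 0 ∧ zStep z d = 1 then (if k = 0 then 1 else 0) else KK k (zStep z d))

lemma ev_ncons (z : ℤ) (k : ℕ) (d : ℤ × ℤ) (f : ℕ → ℤ × ℤ) : ev z 1 (k + 1) (ncons d f) ↔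
    if z < 0 ∧ zStep z d = 1 then k = 0 else ev (zStep z d) 1 k f := by
  have h0 : ren z (ncons d f) 1 ↔ z < 0 ∧ zStep z d = 1 := Iff.rfl
  have hs : (fun t => ncons d f (1 + t)) = f := by
    funext t; rw [add_comm]; rfl
  have hz : zb z (ncons d f) 1 = zStep z d := rfl
  have h1 : cnt z (ncons d f) 1 = if z < 0 ∧ zStep z d = 1 then 1 else 0 := by
    rw [cnt, cnt, zero_add]
    simp only [zero_add, h0]
  rw [ev, add_comm k 1, cnt_add, hs, hz, h1]
  cases k with
  | zero =>
    simp only [add_zero, h0, cnt]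
    by_cases h : z < 0 ∧ zStep z d = 1
    · simp [h]
    · simp only [h, if_false, false_and, false_iff]
      intro h'; exact not_ren_zero _ _ h'.1
  | succ k =>
    rw [ren_add, hs, hz]
    by_cases h : z < 0 ∧ zStep z d = 1
    · simp only [h, and_self, if_true]
      constructor
      · rintro ⟨h2, h3⟩
        have := ren_cnt_pos _ _ _ h2
        omega
      · intro h; omega
    · simp only [h, if_false, zero_add, ev]

lemma PE_ev (k : ℕ) (z : ℤ) : PE k (ev z 1 k) = KK k z := by
  induction k generalizing z with
  | zero =>
    rw [PE, KK]
    simp [ev, not_ren_zero]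
  | succ k ih =>
    rw [PE_succ, KK]
    refine tsum_congr fun d => ?_
    congr 1
    rw [PE_congr k (ev_ncons z k d)]
    by_cases h : z < 0 ∧ zStep z d = 1
    · simp only [h, and_self, if_true]
      by_cases hk : k = 0
      · subst hk
        simp [PE]
      · simp [PE, hk]
    · simp only [h, if_false]
      exact ih _

def SS (z : ℤ) : ℝ≥0∞ := ∑' k, KK k z

lemma sum_KK_le (N : ℕ) (z : ℤ) : ∑ k ∈ Finset.range N, KK k z ≤ 1 := by
  induction N generalizing z with
  | zero => simp
  | succ N ih =>
    rw [Finset.sum_range_succ']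
    simp only [KK, add_zero]
    rw [← Summable.tsum_finsetSum (fun _ _ => ENNReal.summable), ← tsum_wE_one]
    refine ENNReal.tsum_le_tsum fun d => ?_
    rw [← Finset.mul_sum]
    calc _ ≤ wE d * 1 := by
          gcongr
          by_cases h : z < 0 ∧ zStep z d = 1
          · simp only [h, and_self, if_true]
            rw [Finset.sum_ite_eq' ]
            split_ifs
            · exact tsum_wE_one.le
            · positivity
          · simp only [h, if_false]
            exact ih _
      _ = _ := mul_one _

lemma SS_le_one (z : ℤ) : SS z ≤ 1 :=
  ENNReal.tsum_le_of_sum_range_le (fun N => sum_KK_le N z)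

lemma SS_eq (z : ℤ) : SS z =
    ∑' d, wE d * (if z < 0 ∧ zStep z d = 1 then 1 else SS (zStep z d)) := by
  rw [SS, tsum_eq_zero_add' ENNReal.summable]
  simp only [KK, zero_add]
  rw [ENNReal.tsum_comm]
  refine tsum_congr fun d => ?_
  rw [ENNReal.tsum_mul_left]
  congr 1
  by_cases h : z < 0 ∧ zStep z d = 1
  · simp only [h, and_self, if_true]
    rw [tsum_ite_eq]
  · simp only [h, if_false]; rfl

lemma SS_neg (h1 : SS 1 = 1) (n : ℕ) : SS (-(n : ℤ) - 1) = 1 := by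
  by_contra hne
  have hlt : SS (-(n : ℤ) - 1) < 1 := lt_of_le_of_ne (SS_le_one _) hne
  have hs := SS_eq 1
  have : ∑' d, wE d * (if (1:ℤ) < 0 ∧ zStep 1 d = 1 then 1 else SS (zStep 1 d)) < ∑' d, wE d := by
    refine ENNReal.tsum_lt_tsum (i := (((n + 1 : ℕ) : ℤ) + 1, -((n + 1 : ℕ) : ℤ))) ?_ ?_ ?_
    · rw [← hs, h1]; simp
    · intro d
      calc _ ≤ wE d * 1 := by
            gcongr
            split_ifs
            · exact le_rfl
            · exact SS_le_one _
        _ = _ := mul_one _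
    · have hz : zStep 1 (((n + 1 : ℕ) : ℤ) + 1, -((n + 1 : ℕ) : ℤ)) = -(n : ℤ) - 1 := by
        unfold zStep
        rw [if_neg (by simp only; omega), if_pos (by simp only; omega)]
        push_cast; ring
      rw [hz, if_neg (by omega)]
      have hw : 0 < wE (((n + 1 : ℕ) : ℤ) + 1, -((n + 1 : ℕ) : ℤ)) := by
        rw [wE, wSemi_right, ENNReal.ofReal_pos]
        exact mul_pos α_pos (pow_pos γ_pos _)
      calc _ < wE (((n + 1 : ℕ) : ℤ) + 1, -((n + 1 : ℕ) : ℤ)) * 1 :=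
            ENNReal.mul_lt_mul_right hw.ne' ENNReal.ofReal_ne_top hlt
        _ = _ := mul_one _
  rw [← hs, h1, tsum_wE_one] at this
  exact lt_irrefl _ this

lemma SS_zero (h1 : SS 1 = 1) : SS 0 = 1 := by
  rw [SS_eq, tsum_wE]
  have e1 : ∀ i : ℕ, zStep 0 (-(i : ℤ), 1) = 1 := fun i => by
    unfold zStep; rw [if_pos (by norm_num)]; norm_num
  have e2 : ∀ i : ℕ, zStep 0 ((i : ℤ) + 1, -(i : ℤ)) = -(i : ℤ) - 1 := fun i => by
    unfold zStep
    rw [if_neg (by simp), if_pos (by simp)]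
    ring
  simp only [e1, e2, lt_irrefl, false_and, if_false, SS_neg h1, h1, mul_one]
  rw [tsum_α, tsum_α', ← ENNReal.ofReal_add γ_pos.le (by positivity), γ_sq]
  simp

def MM (l : ℕ) : ℝ≥0∞ := ∑' j, PE j (ev 0 l j)

lemma PE_split (l j k : ℕ) :
    PE (j + k) (fun f => ev 0 l j f ∧ ev 0 (l + 1) (j + k) f) = PE j (ev 0 l j) * KK k 1 := by
  rw [PE_congr _ (ev_split l j k), PE_mul j k (ev 0 l j) (ev 1 1 k)
    (fun f f' h => ev_congr 0 l f f' j h), PE_ev]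

lemma PE_ev_succ (l n : ℕ) (hl : 1 ≤ l) : PE n (ev 0 (l + 1) n) =
    ∑ p ∈ Finset.HasAntidiagonal.antidiagonal n, PE p.1 (ev 0 l p.1) * KK p.2 1 := by
  have : ∀ p ∈ Finset.HasAntidiagonal.antidiagonal n, PE p.1 (ev 0 l p.1) * KK p.2 1 =
      PE n (fun f => ev 0 l p.1 f ∧ ev 0 (l + 1) n f) := by
    intro p hp
    rw [← PE_split, Finset.HasAntidiagonal.mem_antidiagonal.1 hp]
  rw [Finset.sum_congr rfl this]
  unfold PE
  rw [← Summable.tsum_finsetSum (fun _ _ => ENNReal.summable)]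
  refine tsum_congr fun g => ?_
  by_cases h : ev 0 (l + 1) n (extFin g)
  · simp only [h, and_true, if_true]
    obtain ⟨j, hj, hjev⟩ := ev_exists 0 (extFin g) l n hl (by rw [h.2]; omega)
    rw [Finset.sum_eq_single (j, n - j)]
    · simp [hjev]
    · rintro ⟨a, b⟩ hab hne
      rw [if_neg]
      intro ha
      have := ev_unique 0 _ l _ _ ha hjev
      simp only [Finset.HasAntidiagonal.mem_antidiagonal] at hab this
      apply hne
      simp only [Prod.mk.injEq]; omega
    · intro hn
      exact absurd (Finset.HasAntidiagonal.mem_antidiagonal.2 (by simp; omega)) hn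
  · simp [h]

lemma MM_succ (l : ℕ) (hl : 1 ≤ l) : MM (l + 1) = MM l * SS 1 := by
  unfold MM
  simp only [PE_ev_succ l _ hl]
  rw [SS, ← ENNReal.tsum_mul_right]
  simp only [← ENNReal.tsum_mul_left]
  rw [← ENNReal.tsum_prod (f := fun a b => PE a (ev 0 l a) * KK b 1),
    ← Finset.HasAntidiagonal.sigmaAntidiagonalEquivProd.tsum_eq, ENNReal.tsum_sigma']
  refine tsum_congr fun n => ?_
  rw [tsum_fintype, ← Finset.sum_coe_sort]
  rfl

lemma MM_eq_one (h1 : SS 1 = 1) (l : ℕ) (hl : 1 ≤ l) : MM l = 1 := by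
  induction l, hl using Nat.le_induction with
  | base =>
    rw [← SS_zero h1, MM, SS]
    exact tsum_congr fun k => PE_ev k 0
  | succ l hl ih => rw [MM_succ l hl, ih, h1, mul_one]

lemma diffProbSemi_eq (h1 : SS 1 = 1) (l k : ℕ) (hl : 1 ≤ l) :
    diffProbSemi l k = (KK k 1).toReal := by
  have hl0 : l ≠ 0 := by omega
  unfold diffProbSemi
  simp only [hl0, if_false, probSemi_eq]
  rw [← ENNReal.tsum_toReal_eq (fun j => ne_top_of_le_ne_top ENNReal.one_ne_top (PE_le_one _ _))]
  congr 1
  have : ∀ j : ℕ, PE (j + k) (fun f => (isRenewal f j ∧ renewalCount f j = l) ∧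
      isRenewal f (j + k) ∧ renewalCount f (j + k) = l + 1) = PE j (ev 0 l j) * KK k 1 := by
    intro j
    rw [← PE_split]
    refine PE_congr _ fun f => ?_
    simp only [isRenewal_iff, renewalCount_eq, ev]
  simp only [this]
  rw [ENNReal.tsum_mul_right]
  have := MM_eq_one h1 l hl
  rw [MM] at this
  rw [this, one_mul]


/-! ### Part 2: the spectral eigenfunctions -/

/-- Generating function (in the uniformising variable) for the state `m ≥ 0`, divided by `u`. -/
def Gp (m : ℕ) (u : ℂ) : ℂ := u * (semiγ * (1 + semiγ * u)) ^ m / (semiγ * (1 + semiγ * u))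

/-- The same for the state `-(n+1)`. -/
def Gn (n : ℕ) (u : ℂ) : ℂ := (u + semiγ) ^ n / (semiγ * (1 + semiγ * u) ^ (n + 1))

def Gz : ℤ → ℂ → ℂ
  | Int.ofNat m => Gp m
  | Int.negSucc n => Gn n

def FF (z : ℤ) (u : ℂ) : ℂ := u * Gz z u

/-- One-step renewal probability. -/
def rho : ℤ → ℝ
  | Int.ofNat _ => 0
  | Int.negSucc n => semiγ ^ (n + 2)

/-- The symbol on the circle. -/
def phC (u : ℂ) : ℂ := semiγ ^ 2 * (u + semiγ) * (1 + semiγ * u) / u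

lemma gC_ne : (semiγ : ℂ) ≠ 0 := by exact_mod_cast γ_pos.ne'

lemma gC_sq : (semiγ : ℂ) ^ 2 = 1 - semiγ := by exact_mod_cast γ_sq

lemma norm_gC : ‖(semiγ : ℂ)‖ = semiγ := by
  rw [Complex.norm_real, Real.norm_of_nonneg γ_pos.le]

lemma norm_v_ge (u : ℂ) (hu : ‖u‖ ≤ 1) : 1 - semiγ ≤ ‖1 + semiγ * u‖ := by
  have h1 : ‖(1 : ℂ)‖ - ‖(semiγ : ℂ) * u‖ ≤ ‖1 + semiγ * u‖ := by
    have := norm_sub_norm_le (1 : ℂ) (-(semiγ * u))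
    simpa using this
  rw [norm_mul, norm_gC, norm_one] at h1
  have := γ_pos
  nlinarith

lemma v_ne (u : ℂ) (hu : ‖u‖ ≤ 1) : 1 + semiγ * u ≠ 0 := by
  have := norm_v_ge u hu
  have h2 := γ_lt
  rw [← norm_pos_iff]; linarith

lemma norm_v_le (u : ℂ) (hu : ‖u‖ ≤ 1) : ‖1 + semiγ * u‖ ≤ 1 + semiγ := by
  have h1 := norm_add_le (1 : ℂ) (semiγ * u)
  rw [norm_mul, norm_gC, norm_one] at h1
  have := γ_pos
  nlinarith

lemma norm_a_eq (u : ℂ) (hu : ‖u‖ = 1) : ‖u + semiγ‖ = ‖1 + semiγ * u‖ := by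
  have h : u.re * u.re + u.im * u.im = 1 := by
    have := Complex.normSq_eq_norm_sq u
    rw [hu, Complex.normSq_apply] at this; linarith
  have : ‖u + semiγ‖ ^ 2 = ‖1 + semiγ * u‖ ^ 2 := by
    rw [← Complex.normSq_eq_norm_sq, ← Complex.normSq_eq_norm_sq, Complex.normSq_apply,
      Complex.normSq_apply]
    simp
    linear_combination (1 - semiγ ^ 2) * h
  exact (sq_eq_sq₀ (norm_nonneg _) (norm_nonneg _)).1 this

lemma a_ne (u : ℂ) (hu : ‖u‖ = 1) : u + semiγ ≠ 0 := by
  rw [← norm_pos_iff, norm_a_eq u hu, norm_pos_iff]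
  exact v_ne u hu.le

lemma norm_FF_le (z : ℤ) (u : ℂ) (hu : ‖u‖ = 1) : ‖FF z u‖ ≤ (semiγ ^ 3)⁻¹ := by
  have hγ := γ_pos
  have h1 := norm_v_ge u hu.le
  rw [← γ_sq] at h1
  have hq : semiγ ^ 3 ≤ semiγ * ‖1 + semiγ * u‖ := by nlinarith
  have hpos : 0 < semiγ ^ 3 := by positivity
  cases z with
  | ofNat m =>
    simp only [FF, Gz, Gp, norm_mul, norm_div, norm_pow, norm_gC, hu, one_mul]
    have h2 : semiγ * ‖1 + semiγ * u‖ ≤ 1 := by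
      have := norm_v_le u hu.le
      have := γ_sq
      nlinarith
    rw [inv_eq_one_div]
    gcongr
    exact pow_le_one₀ (by positivity) h2
  | negSucc n =>
    simp only [FF, Gz, Gn, norm_mul, norm_div, norm_pow, norm_gC, hu, one_mul, norm_a_eq u hu]
    have h3 : 0 < ‖1 + semiγ * u‖ := norm_pos_iff.2 (v_ne u hu.le)
    have : ‖1 + semiγ * u‖ ^ n / (semiγ * ‖1 + semiγ * u‖ ^ (n + 1)) =
        (semiγ * ‖1 + semiγ * u‖)⁻¹ := by
      rw [pow_succ]
      field_simp
    rw [this]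
    gcongr

section steps
variable {E : Type*} [NormedAddCommGroup E] [NormedSpace ℝ E]

lemma hasSum_steps (G : ℤ × ℤ → E) (a b : E)
    (ha : HasSum (fun i : ℕ => (semiα * semiγ ^ i) • G (-(i : ℤ), 1)) a)
    (hb : HasSum (fun i : ℕ => (semiα * semiγ ^ (i + 1)) • G ((i : ℤ) + 1, -(i : ℤ))) b) :
    HasSum (fun d => wSemi d • G d) (a + b) := by
  rw [← stepMap_inj.hasSum_iff]
  · refine HasSum.sum (f := (fun d => wSemi d • G d) ∘ stepMap) ?_ ?_
    · refine ha.congr_fun ?_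
      intro i
      simp only [Function.comp, stepMap, wSemi_left]
    · refine hb.congr_fun ?_
      intro i
      simp only [Function.comp, stepMap, wSemi_right]
  · intro d hne
    have : wSemi d = 0 := by
      rcases d with ⟨x, y⟩
      unfold wSemi
      rw [if_neg, if_neg]
      · rintro ⟨h1, h2⟩
        simp only at h1 h2
        exact hne ⟨Sum.inr (x - 1).toNat, by simp only [stepMap, Prod.mk.injEq]; omega⟩
      · rintro ⟨h1, h2⟩
        simp only at h1 h2
        exact hne ⟨Sum.inl (-x).toNat, by simp only [stepMap, Prod.mk.injEq]; omega⟩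
    simp [this]

end steps

lemma zStep_pos_left (m i : ℕ) : zStep (m : ℤ) (-(i : ℤ), 1) = ((m + 1 : ℕ) : ℤ) := by
  unfold zStep; rw [if_pos (by simp only; omega)]; simp

lemma zStep_pos_right_lt (m i : ℕ) (h : i < m) :
    zStep (m : ℤ) ((i : ℤ) + 1, -(i : ℤ)) = ((m - i : ℕ) : ℤ) := by
  unfold zStep; rw [if_pos (by simp only; omega)]; simp only; omega

lemma zStep_pos_right_ge (m i : ℕ) :
    zStep (m : ℤ) (((i + m : ℕ) : ℤ) + 1, -((i + m : ℕ) : ℤ)) = Int.negSucc i := by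
  unfold zStep; rw [if_neg (by simp only; omega), if_pos (by simp only; omega)]
  simp only; omega

lemma zStep_neg_left_lt (n i : ℕ) (h : i < n + 1) :
    zStep (Int.negSucc n) (-(i : ℤ), 1) = Int.negSucc (n - i) := by
  unfold zStep; rw [if_neg (by simp only; omega), if_pos (by simp only; omega)]
  simp only; omega

lemma zStep_neg_left_ge (n i : ℕ) (h : n + 1 ≤ i) :
    zStep (Int.negSucc n) (-(i : ℤ), 1) = 1 := by
  unfold zStep; rw [if_neg (by simp only; omega), if_neg (by simp only; omega)]

lemma zStep_neg_right (n i : ℕ) :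
    zStep (Int.negSucc n) ((i : ℤ) + 1, -(i : ℤ)) = Int.negSucc (n + i + 1) := by
  unfold zStep; rw [if_neg (by simp only; omega), if_pos (by simp only; omega)]
  simp only; omega

lemma hasSum_geo (u : ℂ) (hu : ‖u‖ = 1) :
    HasSum (fun i : ℕ => (semiγ * ((u + semiγ) / (1 + semiγ * u))) ^ i)
      ((1 + semiγ * u) / semiγ) := by
  have hv := v_ne u hu.le
  have h : ‖semiγ * ((u + semiγ) / (1 + semiγ * u))‖ < 1 := by
    rw [norm_mul, norm_div, norm_a_eq u hu, div_self (norm_ne_zero_iff.2 hv), norm_gC, mul_one]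
    exact γ_lt
  have e : (1 - semiγ * ((u + semiγ) / (1 + semiγ * u)))⁻¹ = (1 + semiγ * u) / semiγ := by
    have hg := gC_ne
    have : 1 - semiγ * ((u + semiγ) / (1 + semiγ * u)) = semiγ / (1 + semiγ * u) := by
      field_simp
      linear_combination - gC_sq
    rw [this, inv_div]
  rw [← e]
  exact hasSum_geometric_of_norm_lt_one h

lemma αC : ((semiα : ℝ) : ℂ) = (semiγ : ℂ) ^ 3 := by rw [α_eq]; push_cast; rfl

lemma eig_pos (m : ℕ) (u : ℂ) (hu : ‖u‖ = 1) :
    HasSum (fun d => wSemi d • FF (zStep (m : ℤ) d) u) (phC u * FF (m : ℤ) u) := by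
  have hv := v_ne u hu.le
  have hg := gC_ne
  have hg2 := gC_sq
  have hu0 : u ≠ 0 := by rw [← norm_pos_iff, hu]; exact one_pos
  set g : ℂ := (semiγ : ℂ) with hgdef
  obtain ⟨v, hvd⟩ : ∃ v, v = 1 + g * u := ⟨_, rfl⟩
  rw [← hvd] at hv
  set q : ℂ := g * (1 + g * u) with hq
  have hqv : q = g * v := by rw [hvd]
  have hq0 : q ≠ 0 := by rw [hqv]; exact mul_ne_zero hg hv
  have hqg : q - g = g ^ 2 * u := by rw [hq]; ring
  have hF : ∀ k : ℕ, FF (k : ℤ) u = u * (u * q ^ k / q) := fun k => rfl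
  have hL : HasSum (fun i : ℕ => (semiα * semiγ ^ i) • FF (zStep (m : ℤ) (-(i : ℤ), 1)) u)
      (g * FF ((m + 1 : ℕ) : ℤ) u) := by
    simp only [zStep_pos_left]
    have := (hasSum_γ semiα).smul_const (FF ((m + 1 : ℕ) : ℤ) u)
    have e : (semiα * (semiγ ^ 2)⁻¹) = semiγ := by
      rw [α_eq]; have := γ_pos; field_simp
    rwa [e, Complex.real_smul] at this
  have hR : HasSum (fun i : ℕ => (semiα * semiγ ^ (i + 1)) •
      FF (zStep (m : ℤ) ((i : ℤ) + 1, -(i : ℤ))) u)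
      (g ^ (m + 2) * u + g ^ 2 * u * (q ^ m - g ^ m)) := by
    have hfin : ∑ i ∈ Finset.range m, (semiα * semiγ ^ (i + 1)) •
        FF (zStep (m : ℤ) ((i : ℤ) + 1, -(i : ℤ))) u = g ^ 2 * u * (q ^ m - g ^ m) := by
      have : ∀ i ∈ Finset.range m, (semiα * semiγ ^ (i + 1)) •
          FF (zStep (m : ℤ) ((i : ℤ) + 1, -(i : ℤ))) u =
          g ^ 4 * u ^ 2 * (g ^ i * q ^ (m - 1 - i)) := by
        intro i hi
        have hi := Finset.mem_range.1 hi
        rw [zStep_pos_right_lt m i hi, hF, Complex.real_smul]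
        push_cast
        rw [αC, show m - i = (m - 1 - i) + 1 by omega, pow_succ q]
        field_simp
        ring
      rw [Finset.sum_congr rfl this, ← Finset.mul_sum]
      have h := Commute.geom_sum₂_mul (Commute.all g q) m
      linear_combination (-g ^ 2 * u) * h -
        (g ^ 2 * u * ∑ i ∈ Finset.range m, g ^ i * q ^ (m - 1 - i)) * hqg
    rw [← hfin, ← hasSum_nat_add_iff (f := fun i : ℕ => (semiα * semiγ ^ (i + 1)) •
        FF (zStep (m : ℤ) ((i : ℤ) + 1, -(i : ℤ))) u)]
    have h := (hasSum_geo u hu).mul_left (g ^ (m + 3) * u / (1 + g * u))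
    have e : g ^ (m + 3) * u / (1 + g * u) * ((1 + g * u) / g) = g ^ (m + 2) * u := by
      rw [← hvd, pow_succ g (m + 2)]
      field_simp
    rw [e] at h
    refine h.congr_fun ?_
    intro i
    rw [zStep_pos_right_ge, Complex.real_smul]
    simp only [FF, Gz, Gn]
    push_cast
    rw [αC, ← hgdef, mul_pow, div_pow, ← hvd]
    field_simp
    ring
  have := hasSum_steps (fun d => FF (zStep (m : ℤ) d) u) _ _ hL hR
  have e : phC u * FF (m : ℤ) u = g * FF ((m + 1 : ℕ) : ℤ) u +
      (g ^ (m + 2) * u + g ^ 2 * u * (q ^ m - g ^ m)) := by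
    rw [hF, hF, phC, ← hgdef, ← hvd, pow_succ q, hqv]
    field_simp
    ring
  rw [e]
  exact this

lemma eig_neg (n : ℕ) (u : ℂ) (hu : ‖u‖ = 1) :
    HasSum (fun d => wSemi d • (if zStep (Int.negSucc n) d = 1 then 0 else
      FF (zStep (Int.negSucc n) d) u))
      (phC u * FF (Int.negSucc n) u - ((semiγ ^ (n + 2) : ℝ) : ℂ)) := by
  have hv := v_ne u hu.le
  have ha := a_ne u hu
  have hg := gC_ne
  have hg2 := gC_sq
  have hu0 : u ≠ 0 := by rw [← norm_pos_iff, hu]; exact one_pos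
  set g : ℂ := (semiγ : ℂ) with hgdef
  obtain ⟨v, hvd⟩ : ∃ v, v = 1 + g * u := ⟨_, rfl⟩
  rw [← hvd] at hv
  set r : ℂ := (u + g) / (1 + g * u) with hr0
  have hr : r = (u + g) / v := by rw [hvd]
  have hrg : r - g = g * u / (1 + g * u) := by
    rw [hr, ← hvd]; field_simp; rw [hvd]; linear_combination (-u) * hg2
  have hF : ∀ k : ℕ, FF (Int.negSucc k) u = u / (g * (1 + g * u)) * r ^ k := by
    intro k
    simp only [FF, Gz, Gn]
    rw [hr, div_pow, ← hgdef, ← hvd, pow_succ]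
    field_simp
  have hL : HasSum (fun i : ℕ => (semiα * semiγ ^ i) •
      (if zStep (Int.negSucc n) (-(i : ℤ), 1) = 1 then 0 else
        FF (zStep (Int.negSucc n) (-(i : ℤ), 1)) u))
      (g * (r ^ (n + 1) - g ^ (n + 1))) := by
    have hfin : ∑ i ∈ Finset.range (n + 1), (semiα * semiγ ^ i) •
      (if zStep (Int.negSucc n) (-(i : ℤ), 1) = 1 then 0 else
        FF (zStep (Int.negSucc n) (-(i : ℤ), 1)) u) = g * (r ^ (n + 1) - g ^ (n + 1)) := by
      have : ∀ i ∈ Finset.range (n + 1), (semiα * semiγ ^ i) •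
          (if zStep (Int.negSucc n) (-(i : ℤ), 1) = 1 then 0 else
            FF (zStep (Int.negSucc n) (-(i : ℤ), 1)) u) =
          g ^ 2 * u / (1 + g * u) * (g ^ i * r ^ (n + 1 - 1 - i)) := by
        intro i hi
        have hi := Finset.mem_range.1 hi
        rw [zStep_neg_left_lt n i hi, if_neg (by omega), hF, Complex.real_smul]
        push_cast
        rw [αC, ← hvd, ← hgdef]
        field_simp
      rw [Finset.sum_congr rfl this, ← Finset.mul_sum]
      have h := Commute.geom_sum₂_mul (Commute.all g r) (n + 1)
      have e : g ^ 2 * u / (1 + g * u) = g * (r - g) := by rw [hrg]; ring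
      rw [e]
      linear_combination (-g) * h
    rw [← hfin]
    refine hasSum_sum_of_ne_finset_zero ?_
    intro i hi
    rw [Finset.mem_range] at hi
    rw [if_pos (zStep_neg_left_ge n i (by omega)), smul_zero]
  have hR : HasSum (fun i : ℕ => (semiα * semiγ ^ (i + 1)) •
      (if zStep (Int.negSucc n) ((i : ℤ) + 1, -(i : ℤ)) = 1 then 0 else
        FF (zStep (Int.negSucc n) ((i : ℤ) + 1, -(i : ℤ))) u))
      (g ^ 2 * u * r ^ (n + 1)) := by
    have h := (hasSum_geo u hu).mul_left (g ^ 3 * u / (1 + g * u) * r ^ (n + 1))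
    have e : g ^ 3 * u / (1 + g * u) * r ^ (n + 1) * ((1 + g * u) / g) =
        g ^ 2 * u * r ^ (n + 1) := by
      rw [← hvd]
      field_simp
    rw [e] at h
    refine h.congr_fun ?_
    intro i
    rw [zStep_neg_right, if_neg (by omega), hF, Complex.real_smul]
    push_cast
    rw [αC, ← hgdef, ← hr0, mul_pow, ← hvd]
    field_simp
    ring
  have := hasSum_steps (fun d => if zStep (Int.negSucc n) d = 1 then 0 else
      FF (zStep (Int.negSucc n) d) u) _ _ hL hR
  have e : phC u * FF (Int.negSucc n) u - ((semiγ ^ (n + 2) : ℝ) : ℂ) =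
      g * (r ^ (n + 1) - g ^ (n + 1)) + g ^ 2 * u * r ^ (n + 1) := by
    rw [hF, phC, ← hgdef, ← hvd]
    have h2 : (u + g) = r * v := by rw [hr]; field_simp
    rw [h2]
    push_cast
    rw [← hgdef]
    field_simp
    rw [hvd]
    ring
  rw [e]
  exact this

lemma eig (z : ℤ) (u : ℂ) (hu : ‖u‖ = 1) :
    HasSum (fun d => wSemi d • (if z < 0 ∧ zStep z d = 1 then 0 else FF (zStep z d) u))
      (phC u * FF z u - ((rho z : ℝ) : ℂ)) := by
  cases z with
  | ofNat m =>
    have h : ¬ (Int.ofNat m < 0) := by simp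
    simp only [h, false_and, if_false, rho]
    simpa using eig_pos m u hu
  | negSucc n =>
    have h : Int.negSucc n < 0 := by omega
    simp only [h, true_and, rho]
    exact eig_neg n u hu

lemma hasSum_rho (z : ℤ) :
    HasSum (fun d => wSemi d • (if z < 0 ∧ zStep z d = 1 then (1 : ℝ) else 0)) (rho z) := by
  cases z with
  | ofNat m =>
    have h : ¬ (Int.ofNat m < 0) := by simp
    simp only [h, false_and, if_false, rho, smul_zero]
    exact hasSum_zero
  | negSucc n =>
    have h : Int.negSucc n < 0 := by omega
    simp only [h, true_and, rho]
    have hR : HasSum (fun i : ℕ => (semiα * semiγ ^ (i + 1)) •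
        (if zStep (Int.negSucc n) ((i : ℤ) + 1, -(i : ℤ)) = 1 then (1 : ℝ) else 0)) 0 := by
      have : ∀ i : ℕ, ¬ (zStep (Int.negSucc n) ((i : ℤ) + 1, -(i : ℤ)) = 1) := by
        intro i; rw [zStep_neg_right]; omega
      simp only [this, if_false, smul_zero]
      exact hasSum_zero
    have hL : HasSum (fun i : ℕ => (semiα * semiγ ^ i) •
        (if zStep (Int.negSucc n) (-(i : ℤ), 1) = 1 then (1 : ℝ) else 0)) (semiγ ^ (n + 2)) := by
      have hfin : ∑ i ∈ Finset.range (n + 1), (semiα * semiγ ^ i) •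
        (if zStep (Int.negSucc n) (-(i : ℤ), 1) = 1 then (1 : ℝ) else 0) = 0 := by
        refine Finset.sum_eq_zero fun i hi => ?_
        rw [zStep_neg_left_lt n i (Finset.mem_range.1 hi), if_neg (by omega), smul_zero]
      have key := hasSum_nat_add_iff (f := fun i : ℕ => (semiα * semiγ ^ i) •
        (if zStep (Int.negSucc n) (-(i : ℤ), 1) = 1 then (1 : ℝ) else 0)) (g := semiγ ^ (n + 2)) (n + 1)
      rw [hfin, add_zero] at key
      rw [← key]
      have h := hasSum_γ (semiα * semiγ ^ (n + 1))
      have e : semiα * semiγ ^ (n + 1) * (semiγ ^ 2)⁻¹ = semiγ ^ (n + 2) := by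
        have := γ_pos
        rw [α_eq]; field_simp; ring
      rw [e] at h
      refine h.congr_fun ?_
      intro i
      rw [if_pos (zStep_neg_left_ge n (i + (n + 1)) (by omega)), smul_eq_mul]
      ring
    have := hasSum_steps (fun d => if zStep (Int.negSucc n) d = 1 then (1 : ℝ) else 0) _ _ hL hR
    rwa [add_zero] at this


/-! ### Part 3: integral representation -/

open Real intervalIntegral Filter Topology MeasureTheory

def ph (θ : ℝ) : ℝ := 1 - 2 * semiγ ^ 3 * (1 - Real.cos θ)

lemma γ_cube : semiγ ^ 3 = 2 * semiγ - 1 := by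
  have h := γ_sq
  linear_combination (semiγ - 1) * h

lemma γ3_pos : 0 < semiγ ^ 3 := pow_pos γ_pos 3

lemma ph_nonneg (θ : ℝ) : 0 ≤ ph θ := by
  have h1 := γ_bounds.2
  have h2 := Real.neg_one_le_cos θ
  have h3 := Real.cos_le_one θ
  have h4 := γ3_pos
  have h5 := γ_cube
  unfold ph
  nlinarith

lemma ph_le_one (θ : ℝ) : ph θ ≤ 1 := by
  have h3 := Real.cos_le_one θ
  have h4 := γ3_pos
  unfold ph
  nlinarith

lemma ph_cont : Continuous ph := by unfold ph; fun_prop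

lemma circle_eq (θ : ℝ) : circleMap 0 1 θ = Real.cos θ + Real.sin θ * Complex.I := by
  simp [circleMap, Complex.exp_mul_I]

lemma norm_circle (θ : ℝ) : ‖circleMap 0 1 θ‖ = 1 := by simp

lemma phC_circle (θ : ℝ) : phC (circleMap 0 1 θ) = (ph θ : ℂ) := by
  have hne : circleMap 0 1 θ ≠ 0 := by
    rw [← norm_pos_iff, norm_circle]; exact one_pos
  have hsc : (Real.sin θ : ℂ) ^ 2 + (Real.cos θ : ℂ) ^ 2 = 1 := by
    exact_mod_cast Real.sin_sq_add_cos_sq θ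
  have hu2 : (circleMap 0 1 θ) ^ 2 + 1 = 2 * Real.cos θ * circleMap 0 1 θ := by
    rw [circle_eq]
    linear_combination (Real.sin θ : ℂ) ^ 2 * Complex.I_sq - hsc
  have hg := gC_sq
  rw [phC, div_eq_iff hne, ph]
  push_cast
  generalize circleMap 0 1 θ = u at *
  rw [Complex.ofReal_cos] at hu2
  linear_combination (semiγ : ℂ) ^ 3 * hu2 + (u * ((semiγ : ℂ)^2 + semiγ + 1)) * hg

lemma Gz_diff (z : ℤ) : DifferentiableOn ℂ (Gz z) (Metric.closedBall 0 1) := by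
  have hv : ∀ u ∈ Metric.closedBall (0 : ℂ) 1, 1 + (semiγ : ℂ) * u ≠ 0 := fun u hu =>
    v_ne u (by simpa using hu)
  have hg := gC_ne
  cases z with
  | ofNat m =>
    show DifferentiableOn ℂ (Gp m) _
    unfold Gp
    refine DifferentiableOn.div (by fun_prop) (by fun_prop) ?_
    intro u hu
    exact mul_ne_zero hg (hv u hu)
  | negSucc n =>
    show DifferentiableOn ℂ (Gn n) _
    unfold Gn
    refine DifferentiableOn.div (by fun_prop) (by fun_prop) ?_
    intro u hu
    exact mul_ne_zero hg (pow_ne_zero _ (hv u hu))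

lemma FF_cont (z : ℤ) : Continuous (fun θ : ℝ => FF z (circleMap 0 1 θ)) := by
  unfold FF
  refine (continuous_circleMap 0 1).mul ?_
  refine (Gz_diff z).continuousOn.comp_continuous (continuous_circleMap 0 1) ?_
  intro θ
  simp

lemma Gz_zero (z : ℤ) : semiγ ^ 3 * (Gz z 0).re = rho z := by
  have hγ := γ_pos
  cases z with
  | ofNat m => simp [Gz, Gp, rho]
  | negSucc n =>
    have : Gz (Int.negSucc n) 0 = ((semiγ ^ n / semiγ : ℝ) : ℂ) := by
      simp [Gz, Gn]
    rw [this, Complex.ofReal_re, rho]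
    field_simp
    ring

def II (k : ℕ) (z : ℤ) : ℝ :=
  semiγ ^ 3 / π * ∫ θ in (0 : ℝ)..(2 * π), (FF z (circleMap 0 1 θ)).im * (Real.sin θ * ph θ ^ k)

lemma II_zero (z : ℤ) : II 0 z = rho z := by
  have hC := DiffContOnCl.circleIntegral_sub_inv_smul (c := 0) (R := 1) (w := 0)
    (f := fun u => Gz z u * (1 - u ^ 2))
    (DifferentiableOn.diffContOnCl_ball (U := Metric.closedBall 0 1)
      ((Gz_diff z).mul (by fun_prop)) subset_rfl) (by simp)
  rw [circleIntegral] at hC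
  have e : ∀ θ : ℝ, deriv (circleMap 0 1) θ • ((circleMap 0 1 θ - 0)⁻¹ •
      (Gz z (circleMap 0 1 θ) * (1 - circleMap 0 1 θ ^ 2))) =
      2 * (FF z (circleMap 0 1 θ) * (Real.sin θ : ℂ)) := by
    intro θ
    have hne : circleMap 0 1 θ ≠ 0 := by
      rw [← norm_pos_iff, norm_circle]; exact one_pos
    have hsc : (Real.sin θ : ℂ) ^ 2 + (Real.cos θ : ℂ) ^ 2 = 1 := by
      exact_mod_cast Real.sin_sq_add_cos_sq θ
    have h1 : 1 - circleMap 0 1 θ ^ 2 = -2 * Complex.I * Real.sin θ * circleMap 0 1 θ := by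
      rw [circle_eq]
      linear_combination (Real.sin θ : ℂ) ^ 2 * Complex.I_sq - hsc
    rw [deriv_circleMap, h1, FF]
    simp only [smul_eq_mul, sub_zero]
    generalize circleMap 0 1 θ = u at *
    field_simp
    linear_combination (-(Gz z u) * Real.sin θ) * Complex.I_sq
  simp only [e] at hC
  rw [intervalIntegral.integral_const_mul] at hC
  have hint : IntervalIntegrable (fun θ : ℝ => FF z (circleMap 0 1 θ) * (Real.sin θ : ℂ)) volume
      0 (2 * π) := by
    refine Continuous.intervalIntegrable ?_ _ _
    exact (FF_cont z).mul (by fun_prop)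
  have him := Complex.imCLM.intervalIntegral_comp_comm hint
  have e2 : ∀ θ : ℝ, Complex.imCLM (FF z (circleMap 0 1 θ) * (Real.sin θ : ℂ)) =
      (FF z (circleMap 0 1 θ)).im * (Real.sin θ * ph θ ^ 0) := by
    intro θ
    rw [Complex.imCLM_apply, Complex.im_mul_ofReal, pow_zero, mul_one]
  simp only [e2] at him
  rw [II, him, ← Gz_zero]
  have h3 : ∫ θ in (0:ℝ)..(2 * π), FF z (circleMap 0 1 θ) * (Real.sin θ : ℂ) =
      ((π : ℝ) : ℂ) * (Complex.I * Gz z 0) := by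
    simp only [smul_eq_mul] at hC
    linear_combination hC / 2
  rw [h3, Complex.imCLM_apply, Complex.im_ofReal_mul]
  simp
  field_simp

lemma hasSum_wSemi : HasSum wSemi 1 := by
  have h1 := hasSum_γ semiα
  have h2 := hasSum_γ (semiα * semiγ)
  have hγ := γ_pos
  have := hasSum_steps (fun _ => (1 : ℝ)) _ _ (by simpa using h1)
    (by
      have : ∀ i : ℕ, (semiα * semiγ ^ (i + 1)) • (1 : ℝ) = semiα * semiγ * semiγ ^ i := by
        intro i; rw [smul_eq_mul]; ring
      simp only [this]
      exact h2)
  simp only [smul_eq_mul, mul_one] at this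
  have e : (1:ℝ) = semiα * (semiγ ^ 2)⁻¹ + semiα * semiγ * (semiγ ^ 2)⁻¹ := by
    rw [α_eq]
    field_simp
    linear_combination -γ_sq
  rw [e]
  exact this

lemma II_succ (k : ℕ) (z : ℤ) :
    HasSum (fun d => wSemi d * (if z < 0 ∧ zStep z d = 1 then 0 else II k (zStep z d)))
      (II (k + 1) z) := by
  have hγ3 := γ3_pos
  have key := intervalIntegral.hasSum_integral_of_dominated_convergence (μ := volume)
    (a := 0) (b := 2 * π) (ι := ℤ × ℤ)
    (F := fun d θ => wSemi d * ((if z < 0 ∧ zStep z d = 1 then 0 else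
      FF (zStep z d) (circleMap 0 1 θ)).im * (Real.sin θ * ph θ ^ k)))
    (f := fun θ => (FF z (circleMap 0 1 θ)).im * (Real.sin θ * ph θ ^ (k + 1)))
    (bound := fun d _ => wSemi d * (semiγ ^ 3)⁻¹)
    (by
      intro d
      refine Continuous.aestronglyMeasurable ?_
      have hc := FF_cont (zStep z d)
      have hp := ph_cont
      split_ifs
      · simp only [Complex.zero_im, zero_mul, mul_zero]
        exact continuous_const
      · exact continuous_const.mul ((Complex.continuous_im.comp hc).mul
          (Real.continuous_sin.mul (hp.pow k))))
    (by
      intro d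
      refine Eventually.of_forall fun θ _ => ?_
      rw [norm_mul, Real.norm_of_nonneg (wSemi_nonneg d)]
      refine mul_le_mul_of_nonneg_left ?_ (wSemi_nonneg d)
      rw [norm_mul, norm_mul, norm_pow]
      have h1 : ‖(if z < 0 ∧ zStep z d = 1 then 0 else
        FF (zStep z d) (circleMap 0 1 θ)).im‖ ≤ (semiγ ^ 3)⁻¹ := by
        refine (Complex.abs_im_le_norm _).trans ?_
        split_ifs
        · simp; positivity
        · exact norm_FF_le _ _ (norm_circle θ)
      have h2 : ‖Real.sin θ‖ ≤ 1 := Real.abs_sin_le_one θ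
      have h3 : ‖ph θ‖ ≤ 1 := by
        rw [Real.norm_of_nonneg (ph_nonneg θ)]; exact ph_le_one θ
      have h4 : ‖ph θ‖ ^ k ≤ 1 := pow_le_one₀ (norm_nonneg _) h3
      have h5 : ‖Real.sin θ‖ * ‖ph θ‖ ^ k ≤ 1 :=
        mul_le_one₀ h2 (by positivity) h4
      calc _ ≤ (semiγ ^ 3)⁻¹ * 1 := by gcongr
        _ = _ := mul_one _)
    (Eventually.of_forall fun θ _ => hasSum_wSemi.summable.mul_right _)
    (by simp)
    (by
      refine Eventually.of_forall fun θ _ => ?_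
      have h := eig z (circleMap 0 1 θ) (norm_circle θ)
      rw [phC_circle] at h
      have h2 := (Complex.hasSum_im h).mul_right (Real.sin θ * ph θ ^ k)
      have e : (((ph θ : ℝ) : ℂ) * FF z (circleMap 0 1 θ) - ((rho z : ℝ) : ℂ)).im *
          (Real.sin θ * ph θ ^ k) =
          (FF z (circleMap 0 1 θ)).im * (Real.sin θ * ph θ ^ (k + 1)) := by
        rw [Complex.sub_im, Complex.im_ofReal_mul, Complex.ofReal_im]; ring
      rw [e] at h2
      refine h2.congr_fun fun d => ?_
      rw [Complex.smul_im, smul_eq_mul, mul_assoc])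
  have key2 := key.mul_left (semiγ ^ 3 / π)
  refine key2.congr_fun fun d => ?_
  rw [intervalIntegral.integral_const_mul]
  split_ifs
  · simp
  · rw [II]; ring

lemma KK_eq (k : ℕ) (z : ℤ) : 0 ≤ II k z ∧ KK (k + 1) z = ENNReal.ofReal (II k z) := by
  induction k generalizing z with
  | zero =>
    have h := hasSum_rho z
    rw [← II_zero] at h
    have hn : ∀ d, 0 ≤ wSemi d • (if z < 0 ∧ zStep z d = 1 then (1 : ℝ) else 0) := fun d => by
      have := wSemi_nonneg d
      rw [smul_eq_mul]
      split_ifs <;> simp [this]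
    refine ⟨h.nonneg hn, ?_⟩
    rw [← h.tsum_eq, ENNReal.ofReal_tsum_of_nonneg hn h.summable, KK]
    refine tsum_congr fun d => ?_
    rw [smul_eq_mul, ENNReal.ofReal_mul (wSemi_nonneg d)]
    congr 1
    simp only [KK]
    split_ifs <;> simp
  | succ k ih =>
    have h := II_succ k z
    have hn0 : ∀ d, 0 ≤ (if z < 0 ∧ zStep z d = 1 then 0 else II k (zStep z d)) := fun d => by
      split_ifs
      · exact le_rfl
      · exact (ih _).1
    have hn : ∀ d, 0 ≤ wSemi d * (if z < 0 ∧ zStep z d = 1 then 0 else II k (zStep z d)) :=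
      fun d => mul_nonneg (wSemi_nonneg d) (hn0 d)
    refine ⟨h.nonneg hn, ?_⟩
    rw [← h.tsum_eq, ENNReal.ofReal_tsum_of_nonneg hn h.summable, KK]
    refine tsum_congr fun d => ?_
    rw [ENNReal.ofReal_mul (wSemi_nonneg d)]
    congr 1
    by_cases h1 : z < 0 ∧ zStep z d = 1
    · simp [h1]
    · simp only [h1, if_false]
      exact (ih _).2

lemma FF_one (θ : ℝ) : (FF 1 (circleMap 0 1 θ)).im = 2 * Real.sin θ * Real.cos θ := by
  have h : FF 1 (circleMap 0 1 θ) = circleMap 0 1 θ ^ 2 := by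
    have hv := v_ne _ (norm_circle θ).le
    have hg := gC_ne
    show circleMap 0 1 θ * Gp 1 (circleMap 0 1 θ) = _
    rw [Gp, pow_one, mul_div_assoc, div_self (mul_ne_zero hg hv)]
    ring
  rw [h, circle_eq, sq, Complex.mul_im]
  simp only [Complex.add_re, Complex.add_im, Complex.ofReal_re, Complex.ofReal_im,
    Complex.re_ofReal_mul, Complex.im_ofReal_mul, Complex.I_re, Complex.I_im]
  ring

lemma II_one (k : ℕ) : II k 1 = semiγ ^ 3 / π * ∫ θ in (0 : ℝ)..(2 * π),
    2 * Real.sin θ * Real.cos θ * (Real.sin θ * ph θ ^ k) := by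
  rw [II]; simp only [FF_one]

def JJ (k : ℕ) : ℝ := 1 / π * ∫ θ in (0 : ℝ)..(2 * π), Real.cos θ * (1 + Real.cos θ) * ph θ ^ k

lemma II_tele (k : ℕ) : II k 1 = JJ k - JJ (k + 1) := by
  have hp := ph_cont
  rw [II_one, JJ, JJ, ← mul_sub, ← intervalIntegral.integral_sub
    (Continuous.intervalIntegrable (by fun_prop) _ _)
    (Continuous.intervalIntegrable (by fun_prop) _ _), div_eq_mul_one_div, mul_comm (semiγ ^ 3),
    mul_assoc, ← intervalIntegral.integral_const_mul]
  congr 1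
  refine intervalIntegral.integral_congr fun θ _ => ?_
  have hsc := Real.sin_sq_add_cos_sq θ
  have e : 1 - ph θ = 2 * semiγ ^ 3 * (1 - Real.cos θ) := by unfold ph; ring
  rw [pow_succ]
  linear_combination (2 * semiγ ^ 3 * Real.cos θ * ph θ ^ k) * hsc -
    (Real.cos θ * (1 + Real.cos θ) * ph θ ^ k) * e

lemma JJ_zero : JJ 0 = 1 := by
  rw [JJ]
  have : ∀ θ : ℝ, Real.cos θ * (1 + Real.cos θ) * ph θ ^ 0 = Real.cos θ + Real.cos θ ^ 2 := by
    intro θ; ring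
  simp only [this]
  rw [intervalIntegral.integral_add (Continuous.intervalIntegrable (by fun_prop) _ _)
    (Continuous.intervalIntegrable (by fun_prop) _ _), integral_cos, integral_cos_sq]
  simp

lemma JJ_tendsto : Tendsto JJ atTop (𝓝 0) := by
  have hp := ph_cont
  have h := intervalIntegral.tendsto_integral_filter_of_dominated_convergence (μ := volume)
    (a := 0) (b := 2 * π) (l := atTop)
    (F := fun (k : ℕ) θ => Real.cos θ * (1 + Real.cos θ) * ph θ ^ k) (f := fun _ => (0 : ℝ))
    (fun _ => 2)
    (Eventually.of_forall fun k => (Continuous.aestronglyMeasurable (by fun_prop)))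
    (Eventually.of_forall fun k => Eventually.of_forall fun θ _ => by
      rw [norm_mul, norm_mul, norm_pow]
      have h2 : ‖Real.cos θ‖ ≤ 1 := Real.abs_cos_le_one θ
      have h2' : ‖1 + Real.cos θ‖ ≤ 2 := by
        refine (norm_add_le _ _).trans ?_
        rw [norm_one]; linarith
      have h3 : ‖ph θ‖ ≤ 1 := by
        rw [Real.norm_of_nonneg (ph_nonneg θ)]; exact ph_le_one θ
      have h4 : ‖ph θ‖ ^ k ≤ 1 := pow_le_one₀ (norm_nonneg _) h3
      calc _ ≤ (1 : ℝ) * 2 * 1 := by gcongr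
        _ = 2 := by norm_num)
    (by simp)
    (by
      have hne : ∀ᵐ θ : ℝ ∂volume, θ ≠ 2 * π := by
        simp [ae_iff]
      filter_upwards [hne] with θ hθ hmem
      rw [Set.uIoc_of_le (by positivity)] at hmem
      have hlt : ph θ < 1 := by
        have hc : Real.cos θ < 1 := by
          refine lt_of_le_of_ne (Real.cos_le_one θ) fun hc => ?_
          have := (Real.cos_eq_one_iff_of_lt_of_lt (x := θ) (by linarith [hmem.1, Real.pi_pos])
            (lt_of_le_of_ne hmem.2 hθ)).1 hc
          linarith [hmem.1]
        have := γ3_pos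
        unfold ph; nlinarith
      have := (tendsto_pow_atTop_nhds_zero_of_lt_one (ph_nonneg θ) hlt).const_mul
        (Real.cos θ * (1 + Real.cos θ))
      simpa using this)
  have := h.const_mul (1 / π)
  rw [intervalIntegral.integral_zero, mul_zero] at this
  exact this

lemma SS_one : SS 1 = 1 := by
  have h : HasSum (fun k => II k 1) 1 := by
    rw [hasSum_iff_tendsto_nat_of_nonneg (fun k => (KK_eq k 1).1)]
    have e : ∀ n, ∑ i ∈ Finset.range n, II i 1 = 1 - JJ n := by
      intro n
      simp only [II_tele]
      rw [Finset.sum_range_sub', JJ_zero]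
    simp only [e]
    simpa using (tendsto_const_nhds (x := (1 : ℝ))).sub JJ_tendsto
  rw [SS, tsum_eq_zero_add' ENNReal.summable]
  have e0 : KK 0 1 = 0 := rfl
  rw [e0, zero_add]
  simp only [(KK_eq _ _).2]
  rw [← ENNReal.ofReal_tsum_of_nonneg (fun k => (KK_eq k 1).1) h.summable, h.tsum_eq]
  simp


/-! ### Part 4: asymptotics -/

open Real intervalIntegral Filter Topology MeasureTheory

def FK (k : ℕ) (x : ℝ) : ℝ :=
  2 * (√k * Real.sin (x / √k)) ^ 2 * Real.cos (x / √k) * ph (x / √k) ^ k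

def FI (k : ℕ) : ℝ → ℝ := (Set.Ioc (-(π * √k)) (π * √k)).indicator (FK k)

lemma FK_cont (k : ℕ) : Continuous (FK k) := by
  have := ph_cont
  unfold FK
  fun_prop

lemma tendsto_sqrt_nat : Tendsto (fun k : ℕ => √(k : ℝ)) atTop atTop :=
  Real.tendsto_sqrt_atTop.comp tendsto_natCast_atTop_atTop

lemma tendsto_div_sqrt (x : ℝ) : Tendsto (fun k : ℕ => x / √(k : ℝ)) atTop (𝓝 0) :=
  tendsto_const_nhds.div_atTop tendsto_sqrt_nat

lemma tendsto_sqrt_sin (x : ℝ) :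
    Tendsto (fun k : ℕ => √(k : ℝ) * Real.sin (x / √k)) atTop (𝓝 x) := by
  have h1 : Tendsto (fun k : ℕ => x * Real.sinc (x / √(k : ℝ))) atTop (𝓝 (x * Real.sinc 0)) :=
    ((Real.continuous_sinc.tendsto 0).comp (tendsto_div_sqrt x)).const_mul x
  rw [Real.sinc_zero, mul_one] at h1
  refine h1.congr' ?_
  filter_upwards [eventually_gt_atTop 0] with k hk
  have hs : 0 < √(k : ℝ) := Real.sqrt_pos.2 (by exact_mod_cast hk)
  by_cases hx : x = 0
  · simp [hx]
  · rw [Real.sinc_of_ne_zero (by positivity)]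
    field_simp

lemma ph_half (y : ℝ) : ph y = 1 + -(4 * semiγ ^ 3 * Real.sin (y / 2) ^ 2) := by
  have h : Real.cos y = 1 - 2 * Real.sin (y / 2) ^ 2 := by
    have h1 := Real.cos_two_mul (y / 2)
    have h2 := Real.sin_sq_add_cos_sq (y / 2)
    rw [mul_div_cancel₀ _ (two_ne_zero)] at h1
    linarith
  unfold ph
  rw [h]; ring

lemma tendsto_ph_pow (x : ℝ) :
    Tendsto (fun k : ℕ => ph (x / √(k : ℝ)) ^ k) atTop (𝓝 (Real.exp (-semiγ ^ 3 * x ^ 2))) := by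
  simp only [ph_half]
  refine Real.tendsto_one_add_pow_exp_of_tendsto ?_
  have h := ((tendsto_sqrt_sin (x / 2)).pow 2).const_mul (-(4 * semiγ ^ 3))
  have e : -(4 * semiγ ^ 3) * (x / 2) ^ 2 = -semiγ ^ 3 * x ^ 2 := by ring
  rw [e] at h
  refine h.congr fun k => ?_
  rw [mul_pow, Real.sq_sqrt (Nat.cast_nonneg k), div_right_comm]
  ring

lemma tendsto_FI (x : ℝ) : Tendsto (fun k => FI k x) atTop
    (𝓝 (2 * x ^ 2 * Real.exp (-semiγ ^ 3 * x ^ 2))) := by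
  have h : Tendsto (fun k => FK k x) atTop (𝓝 (2 * x ^ 2 * Real.exp (-semiγ ^ 3 * x ^ 2))) := by
    have h1 := ((tendsto_sqrt_sin x).pow 2).const_mul 2
    have h2 := (Real.continuous_cos.tendsto 0).comp (tendsto_div_sqrt x)
    have h3 := (h1.mul h2).mul (tendsto_ph_pow x)
    rw [Real.cos_zero, mul_one] at h3
    exact h3
  refine h.congr' ?_
  have hev : ∀ᶠ k : ℕ in atTop, |x| < π * √(k : ℝ) :=
    (tendsto_sqrt_nat.const_mul_atTop Real.pi_pos).eventually_gt_atTop |x|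
  filter_upwards [hev] with k hk
  rw [FI, Set.indicator_of_mem]
  exact ⟨(abs_lt.1 hk).1, (abs_lt.1 hk).2.le⟩

lemma FI_bound (k : ℕ) (x : ℝ) :
    ‖FI k x‖ ≤ 2 * (x ^ (2 : ℝ) * Real.exp (-(4 * semiγ ^ 3 / π ^ 2) * x ^ 2)) := by
  have hb : 0 ≤ 2 * (x ^ (2 : ℝ) * Real.exp (-(4 * semiγ ^ 3 / π ^ 2) * x ^ 2)) := by
    rw [Real.rpow_two]; positivity
  have hγ := γ3_pos
  by_cases hx : x ∈ Set.Ioc (-(π * √(k : ℝ))) (π * √(k : ℝ))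
  swap
  · rw [FI, Set.indicator_of_notMem hx, norm_zero]; exact hb
  rw [FI, Set.indicator_of_mem hx, FK]
  have hs : 0 < √(k : ℝ) := by
    rcases (Real.sqrt_nonneg (k : ℝ)).eq_or_lt with h | h
    · rw [← h] at hx
      simp at hx
    · exact h
  have hk : (0 : ℝ) < k := Real.sqrt_pos.1 hs
  have habs : |x / √(k : ℝ)| ≤ π := by
    rw [abs_div, abs_of_pos hs, div_le_iff₀ hs, abs_le]
    exact ⟨hx.1.le, hx.2⟩
  have h1 : (√(k : ℝ) * Real.sin (x / √k)) ^ 2 ≤ x ^ 2 := by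
    rw [sq_le_sq, abs_mul, abs_of_pos hs]
    calc √(k : ℝ) * |Real.sin (x / √k)| ≤ √(k : ℝ) * |x / √(k : ℝ)| := by
          exact mul_le_mul_of_nonneg_left Real.abs_sin_le_abs hs.le
      _ = |x| := by rw [abs_div, abs_of_pos hs]; field_simp
  have h2 : ‖Real.cos (x / √(k : ℝ))‖ ≤ 1 := Real.abs_cos_le_one _
  have h3 : ph (x / √(k : ℝ)) ^ k ≤ Real.exp (-(4 * semiγ ^ 3 / π ^ 2) * x ^ 2) := by
    have hc := Real.cos_le_one_sub_mul_cos_sq habs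
    have hp : ph (x / √(k : ℝ)) ≤ Real.exp (-(4 * semiγ ^ 3 / π ^ 2) * (x / √k) ^ 2) := by
      have := Real.add_one_le_exp (-(4 * semiγ ^ 3 / π ^ 2) * (x / √(k : ℝ)) ^ 2)
      refine le_trans ?_ this
      have h4 : 2 * semiγ ^ 3 * (2 / π ^ 2 * (x / √(k : ℝ)) ^ 2) ≤
          2 * semiγ ^ 3 * (1 - Real.cos (x / √(k : ℝ))) := by
        gcongr; linarith
      unfold ph
      have h5 : -(4 * semiγ ^ 3 / π ^ 2) * (x / √(k : ℝ)) ^ 2 =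
        -(2 * semiγ ^ 3 * (2 / π ^ 2 * (x / √(k : ℝ)) ^ 2)) := by ring
      rw [h5]; linarith
    calc _ ≤ Real.exp (-(4 * semiγ ^ 3 / π ^ 2) * (x / √k) ^ 2) ^ k :=
          pow_le_pow_left₀ (ph_nonneg _) hp k
      _ = _ := by
        rw [← Real.exp_nat_mul, div_pow, Real.sq_sqrt hk.le]
        congr 1
        field_simp
  rw [norm_mul, norm_mul, norm_mul, norm_pow (ph _), Real.norm_of_nonneg (ph_nonneg _),
    Real.norm_of_nonneg (sq_nonneg _), Real.norm_of_nonneg zero_le_two, Real.rpow_two]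
  calc _ ≤ 2 * x ^ 2 * 1 * Real.exp (-(4 * semiγ ^ 3 / π ^ 2) * x ^ 2) := by
        have := pow_nonneg (ph_nonneg (x / √(k : ℝ))) k
        gcongr
    _ = _ := by ring

lemma gauss_val : ∫ x : ℝ, 2 * x ^ 2 * Real.exp (-semiγ ^ 3 * x ^ 2) =
    √π * (semiγ ^ 3) ^ (-(3 : ℝ) / 2) := by
  have h1 := integral_comp_abs (f := fun x => 2 * x ^ 2 * Real.exp (-semiγ ^ 3 * x ^ 2))
  simp only [sq_abs] at h1
  rw [h1]
  have h2 := integral_rpow_mul_exp_neg_mul_rpow (p := 2) (q := 2) (b := semiγ ^ 3)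
    (by norm_num) (by norm_num) γ3_pos
  simp only [Real.rpow_two] at h2
  simp only [mul_assoc]
  rw [MeasureTheory.integral_const_mul, h2]
  have h3 : Real.Gamma ((2 + 1) / 2) = 1 / 2 * √π := by
    rw [show ((2 : ℝ) + 1) / 2 = 1 / 2 + 1 by norm_num, Real.Gamma_add_one (by norm_num),
      Real.Gamma_one_half_eq]
  rw [h3, show -((2 : ℝ) + 1) / 2 = -3 / 2 by norm_num]
  ring

lemma tendsto_int_FI : Tendsto (fun k => ∫ x, FI k x) atTop
    (𝓝 (√π * (semiγ ^ 3) ^ (-(3 : ℝ) / 2))) := by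
  rw [← gauss_val]
  have hγ := γ3_pos
  refine tendsto_integral_of_dominated_convergence
    (fun x => 2 * (x ^ (2 : ℝ) * Real.exp (-(4 * semiγ ^ 3 / π ^ 2) * x ^ 2))) ?_ ?_ ?_ ?_
  · intro k
    exact (FK_cont k).aestronglyMeasurable.indicator measurableSet_Ioc
  · exact (integrable_rpow_mul_exp_neg_mul_sq (by positivity) (by norm_num)).const_mul 2
  · exact fun k => Eventually.of_forall fun x => FI_bound k x
  · exact Eventually.of_forall tendsto_FI

lemma II_FI (k : ℕ) (hk : 0 < k) :
    II k 1 * (k : ℝ) ^ ((3 : ℝ) / 2) = semiγ ^ 3 / π * ∫ x, FI k x := by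
  have hk' : (0 : ℝ) < k := by exact_mod_cast hk
  have hs : 0 < √(k : ℝ) := Real.sqrt_pos.2 hk'
  let g : ℝ → ℝ := fun θ => 2 * Real.sin θ * Real.cos θ * (Real.sin θ * ph θ ^ k)
  have hper : Function.Periodic g (2 * π) := by
    intro θ
    simp only [g, ph, Real.sin_add_two_pi, Real.cos_add_two_pi]
  have h1 := hper.intervalIntegral_add_eq 0 (-π)
  rw [zero_add, show -π + 2 * π = π by ring] at h1
  have h2 := intervalIntegral.integral_comp_div (a := -(π * √(k : ℝ))) (b := π * √(k : ℝ)) g hs.ne'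
  rw [neg_div, mul_div_cancel_right₀ _ hs.ne', smul_eq_mul, ← h1] at h2
  have h3 : ∫ x, FI k x = k * ∫ x in (-(π * √(k : ℝ)))..(π * √(k : ℝ)), g (x / √k) := by
    have hle : -(π * √(k : ℝ)) ≤ π * √(k : ℝ) := by
      have : 0 ≤ π * √(k : ℝ) := by positivity
      linarith
    unfold FI
    rw [MeasureTheory.integral_indicator measurableSet_Ioc,
      ← intervalIntegral.integral_of_le hle, ← intervalIntegral.integral_const_mul]
    congr 1
    funext x
    simp only [FK, g]
    rw [mul_pow, Real.sq_sqrt hk'.le]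
    ring
  have h4 : (k : ℝ) ^ ((3 : ℝ) / 2) = k * √(k : ℝ) := by
    rw [show (3 : ℝ) / 2 = 1 + 1 / 2 by norm_num, Real.rpow_add hk', Real.rpow_one,
      Real.sqrt_eq_rpow]
  rw [h3, h2, h4, II_one]
  ring

lemma semiβ_eq : semiγ ^ 3 / π * (√π * (semiγ ^ 3) ^ (-(3 : ℝ) / 2)) = semiβ := by
  have hγ := γ_pos
  have hγ3 := γ3_pos
  have hsq := γ_sq
  have h5 : √5 = 2 * semiγ + 1 := by unfold semiγ; ring
  have hπ := Real.pi_pos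
  -- left side
  have hL : semiγ ^ 3 / π * (√π * (semiγ ^ 3) ^ (-(3 : ℝ) / 2)) = 1 / (√π * √(semiγ ^ 3)) := by
    rw [show (-(3 : ℝ) / 2) = -(1 + 1 / 2) by norm_num, Real.rpow_neg hγ3.le,
      Real.rpow_add hγ3, Real.rpow_one, ← Real.sqrt_eq_rpow]
    have hp : π = √π * √π := (Real.mul_self_sqrt hπ.le).symm
    have : 0 < √π := Real.sqrt_pos.2 hπ
    have : 0 < √(semiγ ^ 3) := Real.sqrt_pos.2 hγ3
    rw [div_mul_eq_mul_div, div_eq_div_iff (by positivity) (by positivity)]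
    field_simp
    rw [sq, ← hp]
  have hσ' : semiσ' = √2 / √semiγ := by
    rw [semiσ', ← Real.sqrt_div (by norm_num), h5]
    congr 1
    field_simp
    linear_combination 2 * hsq
  have hσ : semiσ = (1 + semiγ) * semiσ' := by
    rw [semiσ, semiσ', h5, ← Real.sqrt_sq (by positivity : 0 ≤ 1 + semiγ),
      ← Real.sqrt_mul (by positivity)]
    congr 1
    linear_combination (-2 * semiγ - 4) * hsq
  have hs2 : 0 < √(2 : ℝ) := Real.sqrt_pos.2 (by norm_num)
  have hsg : 0 < √semiγ := Real.sqrt_pos.2 hγ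
  have hsp : 0 < √π := Real.sqrt_pos.2 hπ
  have hs3 : √(semiγ ^ 3) = semiγ * √semiγ := by
    rw [pow_succ, Real.sqrt_mul (by positivity), Real.sqrt_sq hγ.le]
  have hgg : √semiγ * √semiγ = semiγ := Real.mul_self_sqrt hγ.le
  have h22 : √(2 : ℝ) * √2 = 2 := Real.mul_self_sqrt (by norm_num)
  rw [hL, semiβ, hσ, hσ', hs3, ← hsq, Real.sqrt_mul (by norm_num)]
  generalize √semiγ = s at *
  generalize √(2 : ℝ) = t at *
  generalize √π = q at *
  have : (1 + semiγ) ≠ 0 := by positivity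
  field_simp
  rw [← hgg]
  linear_combination s ^ 2 * h22

lemma tendsto_II : Tendsto (fun k : ℕ => II k 1 * (k : ℝ) ^ ((3 : ℝ) / 2)) atTop (𝓝 semiβ) := by
  rw [← semiβ_eq]
  refine (tendsto_int_FI.const_mul (semiγ ^ 3 / π)).congr' ?_
  filter_upwards [eventually_gt_atTop 0] with k hk
  exact (II_FI k hk).symm

lemma semiβ_pos : 0 < semiβ := by
  rw [← semiβ_eq]
  have := γ3_pos
  have := Real.pi_pos
  positivity

lemma main_tendsto : Tendsto (fun k : ℕ => diffProbSemi 1 k / (semiβ * (k : ℝ) ^ (-(3:ℝ)/2)))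
    atTop (𝓝 1) := by
  rw [← tendsto_add_atTop_iff_nat 1]
  have hβ := semiβ_pos
  have h1 : Tendsto (fun k : ℕ => (((k + 1 : ℕ) : ℝ) / (k : ℝ)) ^ ((3 : ℝ) / 2)) atTop (𝓝 1) := by
    have h0 : Tendsto (fun k : ℕ => 1 + 1 / (k : ℝ)) atTop (𝓝 (1 + 0)) :=
      tendsto_const_nhds.add tendsto_one_div_atTop_nhds_zero_nat
    rw [add_zero] at h0
    have h2 := h0.rpow_const (p := (3 : ℝ) / 2) (Or.inl one_ne_zero)
    rw [Real.one_rpow] at h2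
    refine h2.congr' ?_
    filter_upwards [eventually_gt_atTop 0] with k hk
    have hk' : (0 : ℝ) < k := by exact_mod_cast hk
    congr 1
    push_cast
    field_simp
    try ring
  have h3 := (tendsto_II.mul h1).div_const semiβ
  rw [mul_one, div_self hβ.ne'] at h3
  refine h3.congr' ?_
  filter_upwards [eventually_gt_atTop 0] with k hk
  have hk' : (0 : ℝ) < k := by exact_mod_cast hk
  have hk1 : (0 : ℝ) < ((k + 1 : ℕ) : ℝ) := by positivity
  rw [diffProbSemi_eq SS_one 1 (k + 1) le_rfl, (KK_eq k 1).2, ENNReal.toReal_ofReal (KK_eq k 1).1,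
    Real.div_rpow hk1.le hk'.le, neg_div, Real.rpow_neg hk1.le]
  have ha : 0 < (k : ℝ) ^ ((3 : ℝ) / 2) := by positivity
  have hb : 0 < ((k + 1 : ℕ) : ℝ) ^ ((3 : ℝ) / 2) := by positivity
  field_simp


end Helpers

/-- the increments `τ⁺_{ℓ+1} - τ⁺_ℓ`, `ℓ ≥ 1`, are identically
distributed, and `P(τ⁺₂ - τ⁺₁ = k) ∼ β k^{-3/2}` as `k → ∞`. -/
theorem semi_baxter_renewal_increment_asymptotics :
    (∀ ℓ : ℕ, 1 ≤ ℓ → ∀ k : ℕ, diffProbSemi ℓ k = diffProbSemi 1 k) ∧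
    Filter.Tendsto (fun k : ℕ => diffProbSemi 1 k / (semiβ * (k : ℝ) ^ (-(3:ℝ)/2)))
      Filter.atTop (nhds 1) := by
  exact ⟨fun l hl k => by
    rw [diffProbSemi_eq SS_one l k hl, diffProbSemi_eq SS_one 1 k le_rfl], main_tendsto⟩
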